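/- arXiv:2502.01818 — 5 statements merged into one kernel-verified Lean document; each statement's English description precedes it below -/
import Mathlib

section
/- Let w₁, w₂, w₃ ∈ ℝ² with w₁ + w₂ + w₃ = 0, and let E > 0 satisfy E < |w₁|/100 and |w₁| − E ≤ |wᵢ| ≤ |w₁| + E for i = 1, 2, 3. Then there is a choice of sign such that |w₂ − R_{±2π/3}(w₁)| ≤ 5E and |w₃ − R_{∓2π/3}(w₁)| ≤ 5E, where the two signs are opposite. -/
open Real

noncomputable section

/-- Euclidean norm of a point of `ℝ²`. -/
def nrm (w : ℝ × ℝ) : ℝ := Real.sqrt (w.1 ^ 2 + w.2 ^ 2)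

/-- Rotation of `ℝ²` about the origin by angle `θ`. -/
def rot (θ : ℝ) (w : ℝ × ℝ) : ℝ × ℝ :=
  (Real.cos θ * w.1 - Real.sin θ * w.2, Real.sin θ * w.1 + Real.cos θ * w.2)

theorem nrm_nonneg (w : ℝ × ℝ) : 0 ≤ nrm w := Real.sqrt_nonneg _

theorem nrm_sq (w : ℝ × ℝ) : nrm w ^ 2 = w.1 ^ 2 + w.2 ^ 2 := Real.sq_sqrt (by positivity)

theorem cos_two_pi_div_three : Real.cos (2 * π / 3) = -1 / 2 := by
  rw [show 2 * π / 3 = π - π / 3 by ring, Real.cos_pi_sub, Real.cos_pi_div_three]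
  norm_num

theorem sin_two_pi_div_three : Real.sin (2 * π / 3) = √3 / 2 := by
  rw [show 2 * π / 3 = π - π / 3 by ring, Real.sin_pi_sub, Real.sin_pi_div_three]

/-- Quantitative uniqueness of the apex of a unit equilateral triangle in a half plane. -/
theorem sq_dist_apex_le {a b e : ℝ} (hb : 0 ≤ b) (he : 0 < e) (he' : e < 1 / 100)
    (hp : (1 - e) ^ 2 ≤ a ^ 2 + b ^ 2) (hp' : a ^ 2 + b ^ 2 ≤ (1 + e) ^ 2)
    (hq : (1 - e) ^ 2 ≤ (1 + a) ^ 2 + b ^ 2) (hq' : (1 + a) ^ 2 + b ^ 2 ≤ (1 + e) ^ 2) :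
    (a + 1 / 2) ^ 2 + (b - √3 / 2) ^ 2 ≤ (5 * e) ^ 2 := by
  have h3 : √3 ^ 2 = 3 := Real.sq_sqrt (by norm_num)
  have h3' : 17 / 10 ≤ √3 := Real.le_sqrt_of_sq_le (by norm_num)
  have ha : (a + 1 / 2) ^ 2 ≤ (2 * e) ^ 2 := sq_le_sq' (by nlinarith) (by nlinarith)
  have hee : e ^ 2 ≤ e / 100 := by nlinarith
  have hu : (b - √3 / 2) * (b + √3 / 2) ≤ 3 * e := by nlinarith
  have hl : -(3 * e) ≤ (b - √3 / 2) * (b + √3 / 2) := by nlinarith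
  have hs : 17 / 20 ≤ b + √3 / 2 := by linarith
  have hd : (b - √3 / 2) ^ 2 ≤ (4 * e) ^ 2 := by
    generalize b - √3 / 2 = d at *
    generalize b + √3 / 2 = t at *
    apply sq_le_sq' <;> by_contra! h <;>
      linarith [mul_le_mul_of_nonneg_left hs he.le,
        mul_le_mul_of_nonneg_right h.le (by linarith : 0 ≤ t)]
  linarith [sq_nonneg e]

theorem exists_sign_sq_dist_apex_le {a b e : ℝ} (he : 0 < e) (he' : e < 1 / 100)
    (hp : (1 - e) ^ 2 ≤ a ^ 2 + b ^ 2) (hp' : a ^ 2 + b ^ 2 ≤ (1 + e) ^ 2)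
    (hq : (1 - e) ^ 2 ≤ (1 + a) ^ 2 + b ^ 2) (hq' : (1 + a) ^ 2 + b ^ 2 ≤ (1 + e) ^ 2) :
    ∃ ε : ℝ, (ε = 1 ∨ ε = -1) ∧
      (a + 1 / 2) ^ 2 + (b - ε * (√3 / 2)) ^ 2 ≤ (5 * e) ^ 2 := by
  rcases le_total 0 b with hb | hb
  · exact ⟨1, Or.inl rfl, by simpa using sq_dist_apex_le hb he he' hp hp' hq hq'⟩
  · refine ⟨-1, Or.inr rfl, ?_⟩
    have h := sq_dist_apex_le (b := -b) (neg_nonneg.2 hb) he he' (by simpa using hp)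
      (by simpa using hp') (by simpa using hq) (by simpa using hq')
    linarith

theorem rot_sign_mul_two_pi_div_three {ε : ℝ} (hε : ε = 1 ∨ ε = -1) (w : ℝ × ℝ) :
    rot (ε * (2 * π / 3)) w =
      (-1 / 2 * w.1 - ε * (√3 / 2) * w.2, ε * (√3 / 2) * w.1 + -1 / 2 * w.2) := by
  rcases hε with rfl | rfl <;>
    simp [rot, cos_two_pi_div_three, sin_two_pi_div_three]

/-- If `w₁ + w₂ + w₃ = 0` and the three vectors have lengths within `E < |w₁|/100` of `|w₁|`,
then `w₂` and `w₃` are within `5E` of the rotations of `w₁` by `±2π/3` (with opposite signs). -/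
theorem equilateral_localization (w₁ w₂ w₃ : ℝ × ℝ) (hsum : w₁ + w₂ + w₃ = 0)
    (E : ℝ) (hE : 0 < E) (hE' : E < nrm w₁ / 100)
    (h1 : nrm w₁ - E ≤ nrm w₁ ∧ nrm w₁ ≤ nrm w₁ + E)
    (h2 : nrm w₁ - E ≤ nrm w₂ ∧ nrm w₂ ≤ nrm w₁ + E)
    (h3 : nrm w₁ - E ≤ nrm w₃ ∧ nrm w₃ ≤ nrm w₁ + E) :
    ∃ ε : ℝ, (ε = 1 ∨ ε = -1) ∧
      nrm (w₂ - rot (ε * (2 * π / 3)) w₁) ≤ 5 * E ∧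
      nrm (w₃ - rot (-ε * (2 * π / 3)) w₁) ≤ 5 * E := by
  have hr : 0 < nrm w₁ := by linarith
  have hr2 := nrm_sq w₁
  set r := nrm w₁
  have h2l : (r - E) ^ 2 ≤ nrm w₂ ^ 2 := pow_le_pow_left₀ (by linarith) h2.1 2
  have h2u : nrm w₂ ^ 2 ≤ (r + E) ^ 2 := pow_le_pow_left₀ (nrm_nonneg _) h2.2 2
  have h3l : (r - E) ^ 2 ≤ nrm w₃ ^ 2 := pow_le_pow_left₀ (by linarith) h3.1 2
  have h3u : nrm w₃ ^ 2 ≤ (r + E) ^ 2 := pow_le_pow_left₀ (nrm_nonneg _) h3.2 2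
  clear_value r
  obtain ⟨x, y⟩ := w₁
  obtain ⟨u, v⟩ := w₂
  obtain rfl : w₃ = (-x - u, -y - v) := by
    rw [← neg_eq_of_add_eq_zero_right hsum]
    ext <;> simp <;> ring
  obtain ⟨e, rfl⟩ : ∃ e, E = r * e := ⟨E / r, by field_simp⟩
  simp only at hr2
  obtain ⟨a, b, rfl, rfl⟩ : ∃ a b, u = a * x - b * y ∧ v = a * y + b * x := by
    refine ⟨(u * x + v * y) / r ^ 2, (x * v - y * u) / r ^ 2, ?_, ?_⟩ <;>
    · field_simp
      rw [hr2]
      ring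
  have hn2 : nrm (a * x - b * y, a * y + b * x) ^ 2 = r ^ 2 * (a ^ 2 + b ^ 2) := by
    rw [nrm_sq, hr2]
    ring
  have hn3 : nrm (-x - (a * x - b * y), -y - (a * y + b * x)) ^ 2 =
      r ^ 2 * ((1 + a) ^ 2 + b ^ 2) := by
    rw [nrm_sq, hr2]
    ring
  have hr2pos : 0 < r ^ 2 := by positivity
  rw [hn2] at h2l h2u
  rw [hn3] at h3l h3u
  rw [show (r - r * e) ^ 2 = r ^ 2 * (1 - e) ^ 2 by ring] at h2l h3l
  rw [show (r + r * e) ^ 2 = r ^ 2 * (1 + e) ^ 2 by ring] at h2u h3u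
  obtain ⟨ε, hε, h⟩ := exists_sign_sq_dist_apex_le (pos_of_mul_pos_right hE hr.le)
    (lt_of_mul_lt_mul_left (by linarith : r * e < r * (1 / 100)) hr.le)
    (le_of_mul_le_mul_left h2l hr2pos) (le_of_mul_le_mul_left h2u hr2pos)
    (le_of_mul_le_mul_left h3l hr2pos) (le_of_mul_le_mul_left h3u hr2pos)
  have hε' : -ε = 1 ∨ -ε = -1 := by
    rcases hε with rfl | rfl <;> simp
  have hfin := mul_le_mul_of_nonneg_left h hr2pos.le
  refine ⟨ε, hε, ?_⟩
  rw [rot_sign_mul_two_pi_div_three hε, rot_sign_mul_two_pi_div_three hε']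
  constructor <;>
  · refine Real.sqrt_le_iff.2 ⟨by positivity, ?_⟩
    refine le_of_eq_of_le ?_ (hfin.trans_eq (by ring))
    rw [hr2]
    simp only [Prod.fst_sub, Prod.snd_sub]
    ring

end
end

section
/- Let 0 < c ≤ 1/640 and let M, N > 0 with 128M ≤ N. Let (ν₀,k₀), (ζ₀,m₀) ∈ ℝ² satisfy θ(ν₀,k₀) + θ(ζ₀,m₀) ≥ N and |θ(ν₀,k₀) − θ(ζ₀,m₀)| ≥ M. Then for every (ν,k), (ζ,m) ∈ ℝ² with |ν−ν₀| ≤ cM, |k−k₀| ≤ cM, |ζ−ζ₀| ≤ 3cM, |m−m₀| ≤ 3cM, and with all of |ν|, |ν₀|, |k|, |k₀|, |ζ|, |ζ₀|, |m|, |m₀| at most 10N, one has |(3ζ² + m²) − (3ν² + k²)| ≥ NM/2. -/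
open Real

noncomputable section

/-- `θ(a,b) = (3a² + b²)^{1/2}`. -/
def theta (a b : ℝ) : ℝ := Real.sqrt (3 * a ^ 2 + b ^ 2)

theorem theta_nonneg (a b : ℝ) : 0 ≤ theta a b := Real.sqrt_nonneg _

theorem theta_sq (a b : ℝ) : theta a b ^ 2 = 3 * a ^ 2 + b ^ 2 :=
  Real.sq_sqrt (by positivity)

theorem abs_sq_sub_sq_le {x y d B : ℝ} (hd : |x - y| ≤ d) (hx : |x| ≤ B) (hy : |y| ≤ B) :
    |x ^ 2 - y ^ 2| ≤ 2 * B * d := by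
  have hadd : |x + y| ≤ 2 * B := (abs_add_le x y).trans (by linarith)
  rw [sq_sub_sq, abs_mul]
  exact mul_le_mul hadd hd (abs_nonneg _) ((abs_nonneg _).trans hadd)

/-- Quantitative transversality: if two base points are `θ`-separated by `M`, then all nearby
points satisfy `|(3ζ² + m²) − (3ν² + k²)| ≥ NM/2`. -/
theorem ZK_transversality_stability (c M N : ℝ) (hc0 : 0 < c) (hc : c ≤ 1 / 640)
    (hM : 0 < M) (hN : 0 < N) (hMN : 128 * M ≤ N)
    (ν₀ k₀ ζ₀ m₀ : ℝ)
    (hsum : N ≤ theta ν₀ k₀ + theta ζ₀ m₀)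
    (hsep : M ≤ |theta ν₀ k₀ - theta ζ₀ m₀|)
    (ν k ζ m : ℝ)
    (hν : |ν - ν₀| ≤ c * M) (hk : |k - k₀| ≤ c * M)
    (hζ : |ζ - ζ₀| ≤ 3 * c * M) (hm : |m - m₀| ≤ 3 * c * M)
    (hbν : |ν| ≤ 10 * N) (hbν₀ : |ν₀| ≤ 10 * N)
    (hbk : |k| ≤ 10 * N) (hbk₀ : |k₀| ≤ 10 * N)
    (hbζ : |ζ| ≤ 10 * N) (hbζ₀ : |ζ₀| ≤ 10 * N)
    (hbm : |m| ≤ 10 * N) (hbm₀ : |m₀| ≤ 10 * N) :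
    N * M / 2 ≤ |(3 * ζ ^ 2 + m ^ 2) - (3 * ν ^ 2 + k ^ 2)| := by
  have hbase : N * M ≤ |(3 * ζ₀ ^ 2 + m₀ ^ 2) - (3 * ν₀ ^ 2 + k₀ ^ 2)| := by
    rw [← theta_sq, ← theta_sq, abs_sub_comm, sq_sub_sq, abs_mul,
      abs_of_nonneg (add_nonneg (theta_nonneg _ _) (theta_nonneg _ _))]
    exact mul_le_mul hsum hsep hM.le (hN.le.trans hsum)
  have hcMN : c * (M * N) ≤ 1 / 640 * (M * N) :=
    mul_le_mul_of_nonneg_right hc (mul_pos hM hN).le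
  have eν := abs_le.mp (abs_sq_sub_sq_le hν hbν hbν₀)
  have ek := abs_le.mp (abs_sq_sub_sq_le hk hbk hbk₀)
  have eζ := abs_le.mp (abs_sq_sub_sq_le hζ hbζ hbζ₀)
  have em := abs_le.mp (abs_sq_sub_sq_le hm hbm hbm₀)
  rcases le_abs.mp hbase with h | h
  · exact le_abs.mpr (Or.inl (by linarith))
  · exact le_abs.mpr (Or.inr (by linarith))

end
end

section
/- For every δ > 0 there exists a constant C_δ > 0 such that for every real polynomial f of degree at most 3, every D > 0, every λ ∈ ℝ, and every Lebesgue-measurable set E ⊆ ℝ with |f′(x)| ≥ D for all x ∈ E, one has ∫_E (1 + |λ − f(x)|)^{−1−δ} dx ≤ C_δ / D. -/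
open MeasureTheory Polynomial

noncomputable section

/-- Change of variables on a set where `f` is injective with derivative of size at least `D`. -/
theorem ofReal_mul_setLIntegral_comp_le_lintegral {f f' : ℝ → ℝ} {s : Set ℝ} {D : ℝ}
    (hs : MeasurableSet s) (hf : ∀ x ∈ s, HasDerivAt f (f' x) x) (hinj : Set.InjOn f s)
    (hD : ∀ x ∈ s, D ≤ |f' x|) (g : ℝ → ENNReal) :
    ENNReal.ofReal D * ∫⁻ x in s, g (f x) ≤ ∫⁻ y, g y :=
  calc ENNReal.ofReal D * ∫⁻ x in s, g (f x)
      = ∫⁻ x in s, ENNReal.ofReal D * g (f x) :=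
        (lintegral_const_mul' _ _ ENNReal.ofReal_ne_top).symm
    _ ≤ ∫⁻ x in s, ENNReal.ofReal |f' x| * g (f x) :=
        setLIntegral_mono' hs fun x hx => by gcongr; exact hD x hx
    _ = ∫⁻ y in f '' s, g y :=
        (lintegral_image_eq_lintegral_abs_deriv_mul hs
          (fun x hx => (hf x hx).hasDerivWithinAt) hinj g).symm
    _ ≤ ∫⁻ y, g y := setLIntegral_le_lintegral _ _

/-- A cubic takes different values at `x < y` if its derivative is positive at both points and
its second derivative has the same sign at both points. -/
theorem cubic_lt_of_deriv_pos {a b c x y : ℝ} (hxy : x < y)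
    (hx : 0 < 3 * a * x ^ 2 + 2 * b * x + c) (hy : 0 < 3 * a * y ^ 2 + 2 * b * y + c)
    (h : 0 ≤ 3 * a * x + b ∧ 0 ≤ 3 * a * y + b ∨ 3 * a * x + b ≤ 0 ∧ 3 * a * y + b ≤ 0) :
    a * x ^ 3 + b * x ^ 2 + c * x < a * y ^ 3 + b * y ^ 2 + c * y := by
  have hh : 0 < y - x := sub_pos.2 hxy
  suffices 0 < a * (x ^ 2 + x * y + y ^ 2) + b * (x + y) + c by
    linarith [mul_pos hh this]
  rcases h with ⟨h1, h2⟩ | ⟨h1, h2⟩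
  · linarith [mul_nonneg hh.le h1, mul_nonneg hh.le h2]
  · linarith [mul_nonneg hh.le (neg_nonneg.2 h1), mul_nonneg hh.le (neg_nonneg.2 h2)]

theorem cubic_ne_of_deriv_same_sign {a b c x y : ℝ} (hxy : x < y)
    (h' : 0 < 3 * a * x ^ 2 + 2 * b * x + c ∧ 0 < 3 * a * y ^ 2 + 2 * b * y + c ∨
      3 * a * x ^ 2 + 2 * b * x + c < 0 ∧ 3 * a * y ^ 2 + 2 * b * y + c < 0)
    (h : 0 ≤ 3 * a * x + b ∧ 0 ≤ 3 * a * y + b ∨ 3 * a * x + b ≤ 0 ∧ 3 * a * y + b ≤ 0) :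
    a * x ^ 3 + b * x ^ 2 + c * x ≠ a * y ^ 3 + b * y ^ 2 + c * y := by
  rcases h' with ⟨hx, hy⟩ | ⟨hx, hy⟩
  · exact (cubic_lt_of_deriv_pos hxy hx hy h).ne
  · have := cubic_lt_of_deriv_pos (a := -a) (b := -b) (c := -c) hxy (by linarith) (by linarith)
      (h.symm.imp (fun h => ⟨by linarith [h.1], by linarith [h.2]⟩)
        (fun h => ⟨by linarith [h.1], by linarith [h.2]⟩))
    intro heq
    linarith

theorem cubic_injOn {a b c d : ℝ} {s : Set ℝ}
    (h' : (∀ x ∈ s, 0 < 3 * a * x ^ 2 + 2 * b * x + c) ∨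
      ∀ x ∈ s, 3 * a * x ^ 2 + 2 * b * x + c < 0)
    (h : (∀ x ∈ s, 0 ≤ 3 * a * x + b) ∨ ∀ x ∈ s, 3 * a * x + b ≤ 0) :
    Set.InjOn (fun x => a * x ^ 3 + b * x ^ 2 + c * x + d) s := by
  have key : ∀ x ∈ s, ∀ y ∈ s, x < y →
      a * x ^ 3 + b * x ^ 2 + c * x ≠ a * y ^ 3 + b * y ^ 2 + c * y := fun x hx y hy hxy =>
    cubic_ne_of_deriv_same_sign hxy (h'.imp (fun h => ⟨h x hx, h y hy⟩) fun h => ⟨h x hx, h y hy⟩)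
      (h.imp (fun h => ⟨h x hx, h y hy⟩) fun h => ⟨h x hx, h y hy⟩)
  intro x hx y hy heq
  have heq' := add_right_cancel heq
  rcases lt_trichotomy x y with hlt | rfl | hlt
  · exact absurd heq' (key x hx y hy hlt)
  · rfl
  · exact absurd heq'.symm (key y hy x hx hlt)

/-- The change of variables bound for a cubic, which is injective on each of the four sets given
by the signs of its first two derivatives. -/
theorem ofReal_mul_setLIntegral_cubic_le {a b c d D : ℝ} (hD : 0 < D) {E : Set ℝ}
    (hE : MeasurableSet E) (hED : ∀ x ∈ E, D ≤ |3 * a * x ^ 2 + 2 * b * x + c|)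
    (g : ℝ → ENNReal) :
    ENNReal.ofReal D * ∫⁻ x in E, g (a * x ^ 3 + b * x ^ 2 + c * x + d) ≤ 4 * ∫⁻ y, g y := by
  set F : ℝ → ℝ := fun x => a * x ^ 3 + b * x ^ 2 + c * x + d
  set F' : ℝ → ℝ := fun x => 3 * a * x ^ 2 + 2 * b * x + c
  have hF (x : ℝ) : HasDerivAt F (F' x) x := by
    have := ((((hasDerivAt_id x).pow 3).const_mul a).add
      (((hasDerivAt_id x).pow 2).const_mul b)).add ((hasDerivAt_id x).const_mul c) |>.add_const d
    refine this.congr_deriv ?_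
    simp [F']
    ring
  set P : Set ℝ := {x | 0 < F' x}
  set N : Set ℝ := {x | F' x < 0}
  set U : Set ℝ := {x | 0 ≤ 3 * a * x + b}
  set L : Set ℝ := {x | 3 * a * x + b ≤ 0}
  have hP : MeasurableSet P := measurableSet_lt (by fun_prop) (by fun_prop)
  have hN : MeasurableSet N := measurableSet_lt (by fun_prop) (by fun_prop)
  have hU : MeasurableSet U := measurableSet_le (by fun_prop) (by fun_prop)
  have hL : MeasurableSet L := measurableSet_le (by fun_prop) (by fun_prop)
  have piece {S T : Set ℝ} (hS : MeasurableSet S) (hT : MeasurableSet T)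
      (h' : S = P ∨ S = N) (h : T = U ∨ T = L) :
      ENNReal.ofReal D * ∫⁻ x in E ∩ (S ∩ T), g (F x) ≤ ∫⁻ y, g y := by
    refine ofReal_mul_setLIntegral_comp_le_lintegral (hE.inter (hS.inter hT)) (fun x _ => hF x)
      (cubic_injOn ?_ ?_) (fun x hx => hED x hx.1) g
    · rcases h' with rfl | rfl
      · exact .inl fun x hx => hx.2.1
      · exact .inr fun x hx => hx.2.1
    · rcases h with rfl | rfl
      · exact .inl fun x hx => hx.2.2
      · exact .inr fun x hx => hx.2.2
  have hcover : E ⊆ (E ∩ (P ∩ U) ∪ E ∩ (P ∩ L)) ∪ (E ∩ (N ∩ U) ∪ E ∩ (N ∩ L)) := by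
    intro x hx
    have hne : F' x ≠ 0 := abs_pos.1 (hD.trans_le (hED x hx))
    rcases hne.lt_or_gt with h1 | h1 <;> rcases le_total 0 (3 * a * x + b) with h2 | h2
    · exact .inr (.inl ⟨hx, h1, h2⟩)
    · exact .inr (.inr ⟨hx, h1, h2⟩)
    · exact .inl (.inl ⟨hx, h1, h2⟩)
    · exact .inl (.inr ⟨hx, h1, h2⟩)
  calc ENNReal.ofReal D * ∫⁻ x in E, g (F x)
      ≤ ENNReal.ofReal D * ((∫⁻ x in E ∩ (P ∩ U), g (F x)) + (∫⁻ x in E ∩ (P ∩ L), g (F x)) +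
          ((∫⁻ x in E ∩ (N ∩ U), g (F x)) + ∫⁻ x in E ∩ (N ∩ L), g (F x))) := by
        gcongr
        exact (lintegral_mono_set hcover).trans <| (lintegral_union_le _ _ _).trans <|
          add_le_add (lintegral_union_le _ _ _) (lintegral_union_le _ _ _)
    _ ≤ (∫⁻ y, g y) + (∫⁻ y, g y) + ((∫⁻ y, g y) + ∫⁻ y, g y) := by
        simp only [mul_add]
        exact add_le_add
          (add_le_add (piece hP hU (.inl rfl) (.inl rfl)) (piece hP hL (.inl rfl) (.inr rfl)))
          (add_le_add (piece hN hU (.inr rfl) (.inl rfl)) (piece hN hL (.inr rfl) (.inr rfl)))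
    _ = 4 * ∫⁻ y, g y := by ring

/-- If a cubic polynomial has derivative of size at least `D` on a measurable set `E`, then
`∫_E (1 + |λ − f(x)|)^{−1−δ} dx ≤ C_δ / D`. -/
theorem cubic_levelset_integral_bound (δ : ℝ) (hδ : 0 < δ) :
    ∃ C : ℝ, 0 < C ∧
      ∀ f : Polynomial ℝ, f.natDegree ≤ 3 →
      ∀ D : ℝ, 0 < D →
      ∀ lam : ℝ, ∀ E : Set ℝ, MeasurableSet E →
        (∀ x ∈ E, D ≤ |(Polynomial.derivative f).eval x|) →
        ∫⁻ x in E, ENNReal.ofReal ((1 + |lam - f.eval x|) ^ (-(1 + δ))) ≤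
          ENNReal.ofReal (C / D) := by
  have hint : Integrable fun y : ℝ => (1 + |y|) ^ (-(1 + δ)) :=
    integrable_one_add_norm (by simpa using hδ)
  have hnonneg (y : ℝ) : 0 ≤ (1 + |y|) ^ (-(1 + δ)) := by positivity
  have hK : 0 ≤ ∫ y : ℝ, (1 + |y|) ^ (-(1 + δ)) := integral_nonneg hnonneg
  refine ⟨4 * (∫ y : ℝ, (1 + |y|) ^ (-(1 + δ))) + 1, by positivity, ?_⟩
  intro f hf D hD lam E hE hED
  have hsum := f.as_sum_range_C_mul_X_pow' (Nat.lt_succ_of_le hf)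
  have heval (x : ℝ) :
      f.eval x = f.coeff 3 * x ^ 3 + f.coeff 2 * x ^ 2 + f.coeff 1 * x + f.coeff 0 := by
    conv_lhs => rw [hsum]
    simp [Finset.sum_range_succ]
    ring
  have hderiv (x : ℝ) : (derivative f).eval x =
      3 * f.coeff 3 * x ^ 2 + 2 * f.coeff 2 * x + f.coeff 1 := by
    conv_lhs => rw [hsum]
    simp [Finset.sum_range_succ]
    ring
  simp only [hderiv] at hED
  simp only [heval]
  have hmain := ofReal_mul_setLIntegral_cubic_le (d := f.coeff 0) hD hE hED
    fun y => ENNReal.ofReal ((1 + |lam - y|) ^ (-(1 + δ)))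
  rw [lintegral_sub_left_eq_self (fun y => ENNReal.ofReal ((1 + |y|) ^ (-(1 + δ)))) lam,
    ← ofReal_integral_eq_lintegral_ofReal hint (.of_forall hnonneg)] at hmain
  rw [ENNReal.ofReal_div_of_pos hD, ENNReal.le_div_iff_mul_le
    (.inl (ENNReal.ofReal_pos.2 hD).ne') (.inl ENNReal.ofReal_ne_top), mul_comm]
  refine hmain.trans ?_
  rw [← ENNReal.ofReal_ofNat 4, ← ENNReal.ofReal_mul (by norm_num)]
  exact ENNReal.ofReal_le_ofReal (by linarith)

end
end

section
/- There exists a universal constant C > 0 such that the following holds: for every real polynomial f of degree at most 3, every D > 0, every interval I ⊆ ℝ with |f′′(x)| ≥ D for all x ∈ I, and all real numbers a ≤ b, the Lebesgue measure of {x ∈ I : a ≤ f(x) ≤ b} is at most C·((b−a)/D)^{1/2}. -/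
open MeasureTheory Polynomial

noncomputable section

/-- The second divided difference of a cubic at three points is half of its second derivative at
their centroid. -/
lemma eval_second_difference_of_natDegree_le_three {f : Polynomial ℝ} (hf : f.natDegree ≤ 3)
    (x y z : ℝ) :
    2 * ((f.eval z - f.eval y) * (y - x) - (f.eval y - f.eval x) * (z - y)) =
      (z - y) * (y - x) * (z - x) *
        (derivative (derivative f)).eval ((x + y + z) / 3) := by
  rw [f.as_sum_range' 4 (by omega)]
  simp only [Finset.sum_range_succ, Finset.sum_range_zero, ← C_mul_X_pow_eq_monomial]
  simp
  ring

/-- If a cubic has second derivative of size at least `D` on an interval, then consecutive gaps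
between points of the interval at which its values lie in `[a, b]` have product at most
`2 (b - a) / D`. -/
lemma mul_gaps_le_of_le_abs_second_derivative {f : Polynomial ℝ} (hf : f.natDegree ≤ 3) {D : ℝ}
    {I : Set ℝ} (hI : I.OrdConnected)
    (hD : ∀ x ∈ I, D ≤ |(derivative (derivative f)).eval x|) {a b x y z : ℝ}
    (hx : x ∈ I ∧ a ≤ f.eval x ∧ f.eval x ≤ b) (hy : a ≤ f.eval y ∧ f.eval y ≤ b)
    (hz : z ∈ I ∧ a ≤ f.eval z ∧ f.eval z ≤ b) (hxy : x < y) (hyz : y < z) :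
    (z - y) * (y - x) * D ≤ 2 * (b - a) := by
  have hc := hD ((x + y + z) / 3) (hI.out hx.1 hz.1 ⟨by linarith, by linarith⟩)
  have key := congrArg abs (eval_second_difference_of_natDegree_le_three hf x y z)
  have hp : 0 < (z - y) * (y - x) := mul_pos (by linarith) (by linarith)
  have hxz : 0 < z - x := by linarith
  rw [abs_mul _ (eval _ _), abs_of_pos (mul_pos hp hxz)] at key
  have h1 : |f.eval z - f.eval y| ≤ b - a := abs_le.2 ⟨by linarith, by linarith⟩
  have h2 : |f.eval y - f.eval x| ≤ b - a := abs_le.2 ⟨by linarith, by linarith⟩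
  have upper : |2 * ((f.eval z - f.eval y) * (y - x) - (f.eval y - f.eval x) * (z - y))| ≤
      2 * ((b - a) * (z - x)) := by
    rw [abs_mul, abs_two]
    refine mul_le_mul_of_nonneg_left ((abs_sub _ _).trans ?_) zero_le_two
    rw [abs_mul, abs_mul, abs_of_pos (sub_pos.2 hxy), abs_of_pos (sub_pos.2 hyz)]
    nlinarith [mul_le_mul_of_nonneg_right h1 (sub_pos.2 hxy).le,
      mul_le_mul_of_nonneg_right h2 (sub_pos.2 hyz).le]
  have lower := mul_le_mul_of_nonneg_left hc (mul_pos hp hxz).le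
  refine le_of_mul_le_mul_right ?_ hxz
  linarith

/-- A measurable set of reals in which the middle one of any three points lies within `s` of one of
the outer two has measure at most `2 * s`. -/
lemma volume_le_of_forall_gap_le {E : Set ℝ} (hE : MeasurableSet E) {s : ℝ} (hs : 0 ≤ s)
    (h : ∀ x ∈ E, ∀ y ∈ E, ∀ z ∈ E, x < y → y < z → y - x ≤ s ∨ z - y ≤ s) :
    volume E ≤ ENNReal.ofReal (2 * s) := by
  rw [hE.measure_eq_iSup_isCompact]
  refine iSup₂_le fun K hKE => iSup_le fun hK => ?_
  rcases K.eq_empty_or_nonempty with rfl | hne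
  · simp
  obtain ⟨m, hm, hmin⟩ := hK.exists_isLeast hne
  obtain ⟨M, hM, hmax⟩ := hK.exists_isGreatest hne
  have hsub : K ⊆ Set.Icc m (m + s) ∪ Set.Icc (M - s) M := by
    intro y hy
    have h1 := hmin hy
    have h2 := hmax hy
    rcases h1.eq_or_lt with rfl | h1'
    · exact Or.inl ⟨le_rfl, by linarith⟩
    rcases h2.eq_or_lt with rfl | h2'
    · exact Or.inr ⟨by linarith, le_rfl⟩
    rcases h m (hKE hm) y (hKE hy) M (hKE hM) h1' h2' with h3 | h3
    · exact Or.inl ⟨h1, by linarith⟩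
    · exact Or.inr ⟨by linarith, h2⟩
  calc volume K ≤ volume (Set.Icc m (m + s)) + volume (Set.Icc (M - s) M) :=
        (measure_mono hsub).trans (measure_union_le _ _)
    _ = ENNReal.ofReal (2 * s) := by
        rw [Real.volume_Icc, Real.volume_Icc, ← ENNReal.ofReal_add (by linarith) (by linarith)]
        ring_nf

/-- If a cubic polynomial has second derivative of size at least `D` on an interval `I`, then the
sublevel set `{x ∈ I : a ≤ f(x) ≤ b}` has measure at most `C ((b−a)/D)^{1/2}`. -/
theorem cubic_sublevel_measure_bound :
    ∃ C : ℝ, 0 < C ∧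
      ∀ f : Polynomial ℝ, f.natDegree ≤ 3 →
      ∀ D : ℝ, 0 < D →
      ∀ I : Set ℝ, I.OrdConnected →
        (∀ x ∈ I, D ≤ |(Polynomial.derivative (Polynomial.derivative f)).eval x|) →
        ∀ a b : ℝ, a ≤ b →
          volume {x ∈ I | a ≤ f.eval x ∧ f.eval x ≤ b} ≤
            ENNReal.ofReal (C * ((b - a) / D) ^ ((1 : ℝ) / 2)) := by
  refine ⟨4, by norm_num, fun f hf D hD I hI hfD a b hab => ?_⟩
  rw [← Real.sqrt_eq_rpow]
  set r := √((b - a) / D) with hr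
  have hr0 : 0 ≤ r := Real.sqrt_nonneg _
  have hrD : r ^ 2 * D = b - a := by
    rw [hr, Real.sq_sqrt (div_nonneg (by linarith) hD.le), div_mul_cancel₀ _ hD.ne']
  have hmeas : MeasurableSet {x ∈ I | a ≤ f.eval x ∧ f.eval x ≤ b} :=
    hI.measurableSet.inter
      ((measurableSet_le measurable_const f.continuous.measurable).inter
        (measurableSet_le f.continuous.measurable measurable_const))
  convert volume_le_of_forall_gap_le hmeas (s := 2 * r) (by linarith) ?_ using 2
  · ring
  intro x hx y hy z hz hxy hyz
  by_contra! hgap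
  have hprod := mul_gaps_le_of_le_abs_second_derivative hf hI hfD hx hy.2 hz hxy hyz
  have hlt : 2 * r * (2 * r) < (z - y) * (y - x) :=
    mul_lt_mul'' hgap.2 hgap.1 (by linarith) (by linarith)
  nlinarith [mul_lt_mul_of_pos_right hlt hD]

end
end

section
/- There exists a universal constant C > 0 such that for every g : ℝ → ℂ with ∫_ℝ (1+x²)|g(x)|² dx < ∞ and ∫_ℝ g(x) dx = 0, one has ∫_{−1}^{1} |ĝ(ξ)|²/|ξ| dξ ≤ C·∫_ℝ (1+x²)|g(x)|² dx. -/
open MeasureTheory Real Complex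

noncomputable section

/-- The Fourier transform `ĝ(ξ) = ∫ e^{−2πixξ} g(x) dx` on `ℝ`. -/
def ft (g : ℝ → ℂ) (ξ : ℝ) : ℂ :=
  ∫ x : ℝ, Complex.exp (-(2 * Real.pi * x * ξ) * Complex.I) * g x

theorem norm_exp_mul_I_sub_one_le_two_mul_rpow (t : ℝ) {α : ℝ} (h0 : 0 ≤ α) (h1 : α ≤ 1) :
    ‖Complex.exp (t * Complex.I) - 1‖ ≤ 2 * |t| ^ α := by
  rcases le_total |t| 1 with h | h
  · have h2 : ‖Complex.exp (Complex.I * t) - 1‖ ≤ ‖t‖ := norm_exp_I_mul_ofReal_sub_one_le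
    rw [mul_comm, Real.norm_eq_abs] at h2
    have h3 : |t| ≤ |t| ^ α := Real.self_le_rpow_of_le_one (abs_nonneg t) h h1
    linarith [abs_nonneg t]
  · have h2 : ‖Complex.exp (t * Complex.I) - 1‖ ≤ ‖Complex.exp (t * Complex.I)‖ + ‖(1 : ℂ)‖ :=
      norm_sub_le _ _
    rw [Complex.norm_exp_ofReal_mul_I, norm_one] at h2
    have h3 : 1 ≤ |t| ^ α := Real.one_le_rpow h h0
    linarith

theorem sq_integral_mul_le {f h : ℝ → ℝ} (hf0 : 0 ≤ f) (hh0 : 0 ≤ h)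
    (hf : MemLp f 2) (hh : MemLp h 2) :
    (∫ x, f x * h x) ^ 2 ≤ (∫ x, f x ^ 2) * ∫ x, h x ^ 2 := by
  have key := integral_mul_le_Lp_mul_Lq_of_nonneg (μ := volume) Real.HolderConjugate.two_two
    (Filter.Eventually.of_forall hf0) (Filter.Eventually.of_forall hh0)
    (by simpa using hf) (by simpa using hh)
  simp only [Real.rpow_two, ← Real.sqrt_eq_rpow] at key
  have hnn : 0 ≤ ∫ x, f x * h x := integral_nonneg fun x => mul_nonneg (hf0 x) (hh0 x)
  calc (∫ x, f x * h x) ^ 2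
      ≤ (√(∫ x, f x ^ 2) * √(∫ x, h x ^ 2)) ^ 2 := pow_le_pow_left₀ hnn key 2
    _ = _ := by
      rw [mul_pow, Real.sq_sqrt (integral_nonneg fun x => sq_nonneg _),
        Real.sq_sqrt (integral_nonneg fun x => sq_nonneg _)]

theorem integrable_one_add_sq_rpow : Integrable fun x : ℝ => (1 + x ^ 2) ^ (-(3 / 4) : ℝ) := by
  have h := integrable_rpow_neg_one_add_norm_sq (E := ℝ) (μ := volume) (r := 3 / 2)
    (by norm_num)
  refine h.congr (Filter.Eventually.of_forall fun x => ?_)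
  norm_num

theorem integrableOn_abs_rpow_neg_half :
    IntegrableOn (fun ξ : ℝ => |ξ| ^ (-(1 / 2) : ℝ)) (Set.Icc (-1) 1) := by
  have h : IntervalIntegrable (fun ξ : ℝ => |ξ| ^ (-(1 / 2) : ℝ)) volume 0 1 := by
    refine (intervalIntegral.intervalIntegrable_rpow' (a := 0) (b := 1) (r := -(1 / 2))
      (by norm_num)).congr fun x hx => ?_
    rw [Set.uIoc_of_le zero_le_one] at hx
    simp [abs_of_pos hx.1]
  have h' : IntervalIntegrable (fun ξ : ℝ => |ξ| ^ (-(1 / 2) : ℝ)) volume (-1) 0 := by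
    have := (IntervalIntegrable.iff_comp_neg (f := fun ξ : ℝ => |ξ| ^ (-(1 / 2) : ℝ)) (by simp)).mp h.symm
    simpa using this
  exact (intervalIntegrable_iff_integrableOn_Icc_of_le (by norm_num)).mp (h'.trans h)

theorem abs_rpow_le_one_add_sq_rpow (x : ℝ) :
    |x| ^ (1 / 4 : ℝ) ≤ (1 + x ^ 2) ^ (-(3 / 8) : ℝ) * √(1 + x ^ 2) := by
  have hx : 0 < 1 + x ^ 2 := by positivity
  rw [Real.sqrt_eq_rpow, ← Real.rpow_add hx]
  have h1 : |x| ≤ √(1 + x ^ 2) := Real.abs_le_sqrt (by linarith)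
  calc |x| ^ (1 / 4 : ℝ) ≤ √(1 + x ^ 2) ^ (1 / 4 : ℝ) :=
        Real.rpow_le_rpow (abs_nonneg x) h1 (by norm_num)
    _ = _ := by
      rw [Real.sqrt_eq_rpow, ← Real.rpow_mul hx.le]
      norm_num

theorem norm_ft_sq_le {g : ℝ → ℂ} (hg : AEStronglyMeasurable g volume)
    (hW : Integrable fun x : ℝ => (1 + x ^ 2) * ‖g x‖ ^ 2) (h0 : ∫ x : ℝ, g x = 0) (ξ : ℝ) :
    ‖ft g ξ‖ ^ 2 ≤ (2 * (2 * π * |ξ|) ^ (1 / 4 : ℝ)) ^ 2 *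
      ((∫ x : ℝ, (1 + x ^ 2) ^ (-(3 / 4) : ℝ)) * ∫ x : ℝ, (1 + x ^ 2) * ‖g x‖ ^ 2) := by
  set f : ℝ → ℝ := fun x => (1 + x ^ 2) ^ (-(3 / 8) : ℝ) with hfdef
  set h : ℝ → ℝ := fun x => √(1 + x ^ 2) * ‖g x‖ with hhdef
  have hf_sq (x : ℝ) : f x ^ 2 = (1 + x ^ 2) ^ (-(3 / 4) : ℝ) := by
    rw [hfdef, ← Real.rpow_natCast, ← Real.rpow_mul (by positivity)]
    norm_num
  have hh_sq (x : ℝ) : h x ^ 2 = (1 + x ^ 2) * ‖g x‖ ^ 2 := by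
    rw [hhdef, mul_pow, Real.sq_sqrt (by positivity)]
  have hf0 : 0 ≤ f := fun x => by simp only [hfdef, Pi.zero_apply]; positivity
  have hh0 : 0 ≤ h := fun x => by simp only [hhdef, Pi.zero_apply]; positivity
  have hf : MemLp f 2 := by
    refine (memLp_two_iff_integrable_sq (Measurable.aestronglyMeasurable (by fun_prop))).mpr ?_
    simpa only [hf_sq] using integrable_one_add_sq_rpow
  have hh : MemLp h 2 := by
    have hm : AEStronglyMeasurable h volume :=
      (Continuous.aestronglyMeasurable (by fun_prop)).mul hg.norm
    refine (memLp_two_iff_integrable_sq hm).mpr ?_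
    simpa only [hh_sq] using hW
  have hfh : Integrable fun x => f x * h x := hf.integrable_mul hh
  have hle (x : ℝ) : |x| ^ (1 / 4 : ℝ) * ‖g x‖ ≤ f x * h x := by
    rw [hhdef, ← mul_assoc]
    exact mul_le_mul_of_nonneg_right (abs_rpow_le_one_add_sq_rpow x) (norm_nonneg _)
  have hgi : Integrable g := by
    refine hfh.mono' hg (Filter.Eventually.of_forall fun x => ?_)
    have hx : (1 : ℝ) ≤ 1 + x ^ 2 := by nlinarith [sq_nonneg x]
    have h1 : 1 ≤ f x * √(1 + x ^ 2) := by
      rw [hfdef, Real.sqrt_eq_rpow, ← Real.rpow_add (by positivity)]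
      exact Real.one_le_rpow hx (by norm_num)
    rw [hhdef, ← mul_assoc]
    exact le_mul_of_one_le_left (norm_nonneg _) h1
  have hexp (x : ℝ) : Complex.exp (-(2 * Real.pi * x * ξ) * Complex.I) =
      Complex.exp ((-(2 * π * x * ξ) : ℝ) * Complex.I) := by push_cast; rfl
  have hei : Integrable fun x : ℝ => Complex.exp (-(2 * Real.pi * x * ξ) * Complex.I) * g x := by
    refine hgi.bdd_mul (c := 1) (Continuous.aestronglyMeasurable (by fun_prop))
      (Filter.Eventually.of_forall fun x => ?_)
    rw [hexp, Complex.norm_exp_ofReal_mul_I]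
  have hft : ft g ξ = ∫ x : ℝ, (Complex.exp (-(2 * Real.pi * x * ξ) * Complex.I) - 1) * g x := by
    simp only [sub_mul, one_mul]
    rw [integral_sub hei hgi, h0, sub_zero, ft]
  have hbound : ‖ft g ξ‖ ≤ 2 * (2 * π * |ξ|) ^ (1 / 4 : ℝ) * ∫ x, f x * h x := by
    rw [hft, ← integral_const_mul]
    refine norm_integral_le_of_norm_le (hfh.const_mul _) (Filter.Eventually.of_forall fun x => ?_)
    have hpi := Real.pi_pos
    have habs : |-(2 * π * x * ξ)| = 2 * π * |ξ| * |x| := by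
      rw [abs_neg, abs_mul, abs_mul, abs_of_pos (by positivity : 0 < 2 * π)]
      ring
    have h1 := norm_exp_mul_I_sub_one_le_two_mul_rpow (-(2 * π * x * ξ)) (α := 1 / 4)
      (by norm_num) (by norm_num)
    rw [habs, Real.mul_rpow (by positivity) (abs_nonneg x)] at h1
    rw [norm_mul, hexp]
    calc _ ≤ 2 * ((2 * π * |ξ|) ^ (1 / 4 : ℝ) * |x| ^ (1 / 4 : ℝ)) * ‖g x‖ :=
          mul_le_mul_of_nonneg_right h1 (norm_nonneg _)
      _ = 2 * (2 * π * |ξ|) ^ (1 / 4 : ℝ) * (|x| ^ (1 / 4 : ℝ) * ‖g x‖) := by ring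
      _ ≤ _ := mul_le_mul_of_nonneg_left (hle x) (by positivity)
  have hcs := sq_integral_mul_le hf0 hh0 hf hh
  simp only [hf_sq, hh_sq] at hcs
  calc ‖ft g ξ‖ ^ 2 ≤ (2 * (2 * π * |ξ|) ^ (1 / 4 : ℝ) * ∫ x, f x * h x) ^ 2 :=
        pow_le_pow_left₀ (norm_nonneg _) hbound 2
    _ = (2 * (2 * π * |ξ|) ^ (1 / 4 : ℝ)) ^ 2 * (∫ x, f x * h x) ^ 2 := mul_pow _ _ _
    _ ≤ _ := mul_le_mul_of_nonneg_left hcs (sq_nonneg _)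

theorem sq_two_mul_rpow_div_abs_le (ξ : ℝ) :
    (2 * (2 * π * |ξ|) ^ (1 / 4 : ℝ)) ^ 2 / |ξ| ≤ 4 * √(2 * π) * |ξ| ^ (-(1 / 2) : ℝ) := by
  have hpi := Real.pi_pos
  rcases eq_or_ne ξ 0 with rfl | hξ
  · simp
  have hξ' : 0 < |ξ| := abs_pos.mpr hξ
  apply le_of_eq
  rw [mul_pow, ← Real.rpow_natCast ((2 * π * |ξ|) ^ (1 / 4 : ℝ)), ← Real.rpow_mul (by positivity),
    Real.mul_rpow (by positivity) hξ'.le, Real.sqrt_eq_rpow,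
    show (-(1 / 2) : ℝ) = 1 / 2 - 1 by norm_num, Real.rpow_sub_one hξ'.ne']
  norm_num
  ring

/-- For `g` with `∫ (1+x²)|g|² < ∞` and `∫ g = 0`, the Fourier transform satisfies
`∫_{−1}^{1} |ĝ(ξ)|²/|ξ| dξ ≤ C ∫ (1+x²)|g(x)|² dx`. -/
theorem weighted_low_frequency_bound :
    ∃ C : ℝ, 0 < C ∧
      ∀ g : ℝ → ℂ, AEStronglyMeasurable g volume →
        Integrable (fun x : ℝ => (1 + x ^ 2) * ‖g x‖ ^ 2) →
        (∫ x : ℝ, g x) = 0 →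
        ∫⁻ ξ in Set.Icc (-1 : ℝ) 1, ENNReal.ofReal (‖ft g ξ‖ ^ 2 / |ξ|) ≤
          ENNReal.ofReal (C * ∫ x : ℝ, (1 + x ^ 2) * ‖g x‖ ^ 2) := by
  set K : ℝ := ∫ x : ℝ, (1 + x ^ 2) ^ (-(3 / 4) : ℝ)
  set J : ℝ := ∫ ξ in Set.Icc (-1 : ℝ) 1, |ξ| ^ (-(1 / 2) : ℝ)
  have hK : 0 ≤ K := integral_nonneg fun x => by positivity
  have hJ : 0 ≤ J := integral_nonneg fun x => by positivity
  refine ⟨4 * √(2 * π) * K * J + 1, by positivity, fun g hg hW h0 => ?_⟩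
  set W : ℝ := ∫ x : ℝ, (1 + x ^ 2) * ‖g x‖ ^ 2
  have hW0 : 0 ≤ W := integral_nonneg fun x => by positivity
  have hpt (ξ : ℝ) : ‖ft g ξ‖ ^ 2 / |ξ| ≤ 4 * √(2 * π) * K * W * |ξ| ^ (-(1 / 2) : ℝ) := by
    calc ‖ft g ξ‖ ^ 2 / |ξ|
        ≤ (2 * (2 * π * |ξ|) ^ (1 / 4 : ℝ)) ^ 2 * (K * W) / |ξ| :=
          div_le_div_of_nonneg_right (norm_ft_sq_le hg hW h0 ξ) (abs_nonneg ξ)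
      _ = (2 * (2 * π * |ξ|) ^ (1 / 4 : ℝ)) ^ 2 / |ξ| * (K * W) := by ring
      _ ≤ 4 * √(2 * π) * |ξ| ^ (-(1 / 2) : ℝ) * (K * W) :=
          mul_le_mul_of_nonneg_right (sq_two_mul_rpow_div_abs_le ξ) (by positivity)
      _ = _ := by ring
  calc ∫⁻ ξ in Set.Icc (-1 : ℝ) 1, ENNReal.ofReal (‖ft g ξ‖ ^ 2 / |ξ|)
      ≤ ∫⁻ ξ in Set.Icc (-1 : ℝ) 1,
          ENNReal.ofReal (4 * √(2 * π) * K * W * |ξ| ^ (-(1 / 2) : ℝ)) :=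
        lintegral_mono fun ξ => ENNReal.ofReal_le_ofReal (hpt ξ)
    _ = ENNReal.ofReal (4 * √(2 * π) * K * W * J) := by
        rw [← ofReal_integral_eq_lintegral_ofReal (integrableOn_abs_rpow_neg_half.const_mul _)
          (Filter.Eventually.of_forall fun ξ => by positivity), integral_const_mul]
    _ ≤ _ := ENNReal.ofReal_le_ofReal (by linarith)

end
end
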